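/- Let n ≥ 1, let h be a homogeneous harmonic polynomial of degree m in ℂ[X_1,…,X_n], and let k ≤ d be natural numbers. Then Δ^k(q_n^d · h) = 2^k · (d!/(d−k)!) · (∏_{j=1}^{k} (n + 2(d+m−j))) · q_n^{d−k} · h, where Δ = Σ_{i=1}^n ∂²/∂X_i² is the Laplace operator. -/

import Mathlib

open MvPolynomial

noncomputable def qpoly (n : ℕ) : MvPolynomial (Fin n) ℂ :=
  ∑ i : Fin n, X i ^ 2

noncomputable def linForm {n : ℕ} (a : Fin n → ℂ) : MvPolynomial (Fin n) ℂ :=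
  ∑ i : Fin n, C (a i) * X i

noncomputable def dotC {n : ℕ} (a b : Fin n → ℂ) : ℂ :=
  ∑ i : Fin n, a i * b i

noncomputable def diffOp {n : ℕ} (φ f : MvPolynomial (Fin n) ℂ) : MvPolynomial (Fin n) ℂ :=
  ∑ d ∈ φ.support, φ.coeff d •
    ((List.ofFn fun i : Fin n =>
        ((pderiv i).toLinearMap : MvPolynomial (Fin n) ℂ →ₗ[ℂ] MvPolynomial (Fin n) ℂ) ^ d i).prod f)

noncomputable def lap {n : ℕ} (f : MvPolynomial (Fin n) ℂ) : MvPolynomial (Fin n) ℂ :=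
  ∑ i : Fin n, pderiv i (pderiv i f)

theorem lap_smul {n : ℕ} (c : ℂ) (f : MvPolynomial (Fin n) ℂ) : lap (c • f) = c • lap f := by
  simp [lap, Finset.smul_sum]

theorem pderiv_qpoly {n : ℕ} (i : Fin n) : pderiv i (qpoly n) = 2 * X i := by
  classical
  simp [qpoly, pderiv_X, Pi.single_apply]

theorem isHomogeneous_qpoly (n : ℕ) : (qpoly n).IsHomogeneous 2 :=
  IsHomogeneous.sum _ _ _ fun i _ ↦ isHomogeneous_X_pow i 2

/-- Commutation of the Laplacian with multiplication by the quadratic form. -/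
theorem lap_qpoly_mul {n m : ℕ} {g : MvPolynomial (Fin n) ℂ} (hg : g.IsHomogeneous m) :
    lap (qpoly n * g) = (2 * (n : ℂ) + 4 * (m : ℂ)) • g + qpoly n * lap g := by
  have hsecond (i : Fin n) : pderiv i (pderiv i (qpoly n * g)) =
      2 * g + 4 * (X i * pderiv i g) + qpoly n * pderiv i (pderiv i g) := by
    have h2 : pderiv i (2 : MvPolynomial (Fin n) ℂ) = 0 := pderiv_C (a := (2 : ℂ))
    simp only [pderiv_mul, pderiv_qpoly, map_add, pderiv_X_self, h2]
    ring
  simp only [lap, hsecond, Finset.sum_add_distrib, ← Finset.mul_sum, hg.sum_X_mul_pderiv]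
  simp only [Finset.sum_const, Finset.card_univ, Fintype.card_fin, nsmul_eq_mul, smul_eq_C_mul,
    map_add, map_mul, map_natCast, map_ofNat]
  ring

theorem lap_qpoly_pow_succ_mul_harmonic {n m : ℕ} {h : MvPolynomial (Fin n) ℂ}
    (hhom : h.IsHomogeneous m) (hharm : lap h = 0) (d : ℕ) :
    lap (qpoly n ^ (d + 1) * h) =
      (2 * ((d : ℂ) + 1) * ((n : ℂ) + 2 * ((d : ℂ) + (m : ℂ)))) • (qpoly n ^ d * h) := by
  induction d with
  | zero =>
    rw [zero_add, pow_one, lap_qpoly_mul hhom, hharm, pow_zero, one_mul, mul_zero, add_zero]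
    congr 1
    push_cast
    ring
  | succ d ih =>
    rw [pow_succ' _ (d + 1), mul_assoc,
      lap_qpoly_mul (((isHomogeneous_qpoly n).pow (d + 1)).mul hhom), ih, mul_smul_comm,
      ← mul_assoc, ← pow_succ', ← add_smul]
    congr 1
    push_cast
    ring

/-- For h homogeneous harmonic of degree m and k ≤ d,
Δ^k(q_n^d · h) = 2^k · d!/(d−k)! · (∏_{j=1}^{k} (n + 2(d+m−j))) · q_n^{d−k} · h. -/
theorem lap_iterate_qpow_mul_harmonic (n m d k : ℕ) (hn : 1 ≤ n) (hk : k ≤ d)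
    (h : MvPolynomial (Fin n) ℂ) (hhom : h.IsHomogeneous m) (hharm : lap h = 0) :
    (lap (n := n))^[k] (qpoly n ^ d * h) =
      ((2 : ℂ) ^ k * (Nat.factorial d : ℂ) / (Nat.factorial (d - k) : ℂ) *
          ∏ j ∈ Finset.range k, ((n : ℂ) + 2 * ((d : ℂ) + (m : ℂ) - ((j : ℂ) + 1)))) •
        (qpoly n ^ (d - k) * h) := by
  induction k with
  | zero => simp [Nat.factorial_ne_zero]
  | succ k ih =>
    obtain ⟨e, rfl⟩ := Nat.exists_eq_add_of_le' hk
    rw [Function.iterate_succ_apply', ih (by omega), lap_smul,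
      show e + (k + 1) - k = e + 1 by omega, Nat.add_sub_cancel,
      lap_qpoly_pow_succ_mul_harmonic hhom hharm, smul_smul, Finset.prod_range_succ,
      Nat.factorial_succ e]
    congr 1
    have he : (Nat.factorial e : ℂ) ≠ 0 := by exact_mod_cast Nat.factorial_ne_zero e
    have he1 : (e : ℂ) + 1 ≠ 0 := by exact_mod_cast Nat.succ_ne_zero e
    push_cast
    field_simp
    ring
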